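/- Let X, Y, Z, Z' be finitely supported random variables taking values in an abelian group G, with Y, Z, Z' independent. Then d[X; Y − Z | Y − Z − Z'] − d[X; Y] ≤ (1/2)(H[Y − Z − Z'] + H[Y − Z] − H[Y] − H[Z']). -/

import Mathlib

open scoped Classical BigOperators Pointwise
open Finset

noncomputable section

/-- The probability that the random variable `X` equals `s`, under the pmf `μ`. -/
def pmass {Ω S : Type*} [Fintype Ω] (μ : Ω → ℝ) (X : Ω → S) (s : S) : ℝ :=
  ∑ ω, if X ω = s then μ ω else 0

/-- `μ` is a probability mass function on the finite type `Ω`. -/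
def IsProb {Ω : Type*} [Fintype Ω] (μ : Ω → ℝ) : Prop :=
  (∀ ω, 0 ≤ μ ω) ∧ ∑ ω, μ ω = 1

/-- Shannon entropy `H[X]` of a random variable `X : Ω → S` under `μ`. -/
def ent {Ω S : Type*} [Fintype Ω] (μ : Ω → ℝ) (X : Ω → S) : ℝ :=
  ∑ s ∈ Finset.univ.image X, Real.negMulLog (pmass μ X s)

/-- Mutual information `I[X : Y]`. -/
def mutualInfo {Ω S T : Type*} [Fintype Ω] (μ : Ω → ℝ) (X : Ω → S) (Y : Ω → T) : ℝ :=
  ent μ X + ent μ Y - ent μ (fun ω => (X ω, Y ω))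

/-- The conditional measure, conditioning on the event `Y = y`. -/
def condMeas {Ω T : Type*} [Fintype Ω] (μ : Ω → ℝ) (Y : Ω → T) (y : T) : Ω → ℝ :=
  fun ω => if Y ω = y then μ ω / pmass μ Y y else 0

/-- Conditional mutual information `I[X : Y | Z]`. -/
def condMutualInfo {Ω S T U : Type*} [Fintype Ω] (μ : Ω → ℝ)
    (X : Ω → S) (Y : Ω → T) (Z : Ω → U) : ℝ :=
  ∑ z ∈ Finset.univ.image Z, pmass μ Z z * mutualInfo (condMeas μ Z z) X Y

/-- Entropic Ruzsa distance `d[X ; Y]`, defined via independent copies on a product space. -/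
def rdist {Ω₁ Ω₂ G : Type*} [Fintype Ω₁] [Fintype Ω₂] [AddCommGroup G]
    (μ₁ : Ω₁ → ℝ) (X : Ω₁ → G) (μ₂ : Ω₂ → ℝ) (Y : Ω₂ → G) : ℝ :=
  ent (fun p : Ω₁ × Ω₂ => μ₁ p.1 * μ₂ p.2) (fun p => X p.1 - Y p.2)
    - ent μ₁ X / 2 - ent μ₂ Y / 2

/-- Conditional Ruzsa distance `d[X | Z ; Y | W]`. -/
def condRdist {Ω₁ Ω₂ G T U : Type*} [Fintype Ω₁] [Fintype Ω₂] [AddCommGroup G]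
    (μ₁ : Ω₁ → ℝ) (X : Ω₁ → G) (Z : Ω₁ → T)
    (μ₂ : Ω₂ → ℝ) (Y : Ω₂ → G) (W : Ω₂ → U) : ℝ :=
  ∑ z ∈ Finset.univ.image Z, ∑ w ∈ Finset.univ.image W,
    pmass μ₁ Z z * pmass μ₂ W w * rdist (condMeas μ₁ Z z) X (condMeas μ₂ W w) Y

/-- Conditional Ruzsa distance `d[X ; Y | W]`, conditioning only on the right variable. -/
def condRdistRight {Ω₁ Ω₂ G U : Type*} [Fintype Ω₁] [Fintype Ω₂] [AddCommGroup G]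
    (μ₁ : Ω₁ → ℝ) (X : Ω₁ → G)
    (μ₂ : Ω₂ → ℝ) (Y : Ω₂ → G) (W : Ω₂ → U) : ℝ :=
  ∑ w ∈ Finset.univ.image W, pmass μ₂ W w * rdist μ₁ X (condMeas μ₂ W w) Y

/-- The uniform probability mass function on a subset `H` of a finite type. -/
def unifOn {G : Type*} [Fintype G] (H : Set G) : G → ℝ :=
  fun g => if g ∈ H then ((Nat.card H : ℝ))⁻¹ else 0

/-- `X` (under `μ₁`) and `Y` (under `μ₂`) are identically distributed. -/
def IdentDist {Ω₁ Ω₂ S : Type*} [Fintype Ω₁] [Fintype Ω₂]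
    (μ₁ : Ω₁ → ℝ) (X : Ω₁ → S) (μ₂ : Ω₂ → ℝ) (Y : Ω₂ → S) : Prop :=
  ∀ s, pmass μ₁ X s = pmass μ₂ Y s

/-- Two random variables are independent. -/
def IndepPair {Ω S T : Type*} [Fintype Ω] (μ : Ω → ℝ) (X : Ω → S) (Y : Ω → T) : Prop :=
  ∀ s t, pmass μ (fun ω => (X ω, Y ω)) (s, t) = pmass μ X s * pmass μ Y t

/-- Three random variables are jointly independent. -/
def IndepTriple {Ω S T U : Type*} [Fintype Ω] (μ : Ω → ℝ)
    (X : Ω → S) (Y : Ω → T) (Z : Ω → U) : Prop :=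
  ∀ s t u, pmass μ (fun ω => (X ω, Y ω, Z ω)) (s, t, u)
    = pmass μ X s * pmass μ Y t * pmass μ Z u

/-- Four random variables are jointly independent. -/
def IndepFour {Ω S T U V : Type*} [Fintype Ω] (μ : Ω → ℝ)
    (X : Ω → S) (Y : Ω → T) (Z : Ω → U) (W : Ω → V) : Prop :=
  ∀ s t u v, pmass μ (fun ω => (X ω, Y ω, Z ω, W ω)) (s, t, u, v)
    = pmass μ X s * pmass μ Y t * pmass μ Z u * pmass μ W v


lemma pmass_congr' {Ω S S' : Type*} [Fintype Ω] (μ : Ω → ℝ) (X : Ω → S) (X' : Ω → S') (s : S) (s' : S')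
    (h : ∀ ω, X ω = s ↔ X' ω = s') : pmass μ X s = pmass μ X' s' := by
  unfold pmass
  refine Finset.sum_congr rfl fun ω _ => ?_
  by_cases h1 : X ω = s
  · rw [if_pos h1, if_pos ((h ω).1 h1)]
  · rw [if_neg h1, if_neg (fun h2 => h1 ((h ω).2 h2))]

lemma pmass_nn {Ω S : Type*} [Fintype Ω] {μ : Ω → ℝ} (h : ∀ ω, 0 ≤ μ ω) (X : Ω → S) (s : S) :
    0 ≤ pmass μ X s := by
  unfold pmass
  refine Finset.sum_nonneg fun ω _ => ?_
  split_ifs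
  · exact h ω
  · exact le_rfl

lemma le_pmass {Ω S : Type*} [Fintype Ω] {μ : Ω → ℝ} (h : ∀ ω, 0 ≤ μ ω) (X : Ω → S) (ω : Ω) :
    μ ω ≤ pmass μ X (X ω) := by
  unfold pmass
  have := Finset.single_le_sum (f := fun ω' => if X ω' = X ω then μ ω' else 0) (s := Finset.univ)
    (fun i _ => by split_ifs; exacts [h i, le_rfl]) (Finset.mem_univ ω)
  simpa using this

lemma ent_eq {Ω S : Type*} [Fintype Ω] (μ : Ω → ℝ) (X : Ω → S) :
    ent μ X = ∑ ω, μ ω * (-Real.log (pmass μ X (X ω))) := by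
  unfold ent
  have h1 : ∀ s ∈ Finset.univ.image X, Real.negMulLog (pmass μ X s)
      = ∑ ω, if X ω = s then μ ω * (-Real.log (pmass μ X s)) else 0 := by
    intro s _
    rw [Real.negMulLog]
    conv_lhs => rw [neg_mul, ← mul_neg]
    conv_lhs => lhs; unfold pmass
    rw [Finset.sum_mul]
    refine Finset.sum_congr rfl fun ω _ => ?_
    split_ifs <;> simp
  rw [Finset.sum_congr rfl h1, Finset.sum_comm]
  refine Finset.sum_congr rfl fun ω _ => ?_
  rw [Finset.sum_ite_eq]
  simp

lemma ent_congr {Ω S S' : Type*} [Fintype Ω] (μ : Ω → ℝ) (X : Ω → S) (X' : Ω → S')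
    (h : ∀ ω ω', X ω = X ω' ↔ X' ω = X' ω') : ent μ X = ent μ X' := by
  rw [ent_eq, ent_eq]
  refine Finset.sum_congr rfl fun ω _ => ?_
  rw [pmass_congr' μ X X' (X ω) (X' ω) (fun ω' => h ω' ω)]

lemma ent_indep {Ω S T : Type*} [Fintype Ω] {μ : Ω → ℝ} (hμ : ∀ ω, 0 ≤ μ ω) (X : Ω → S) (Y : Ω → T)
    (h : IndepPair μ X Y) : ent μ (fun ω => (X ω, Y ω)) = ent μ X + ent μ Y := by
  rw [ent_eq, ent_eq, ent_eq, ← Finset.sum_add_distrib]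
  refine Finset.sum_congr rfl fun ω _ => ?_
  rw [h (X ω) (Y ω)]
  rcases (hμ ω).eq_or_lt with h0 | h0
  · rw [← h0]; simp
  · rw [Real.log_mul (h0.trans_le (le_pmass hμ X ω)).ne' (h0.trans_le (le_pmass hμ Y ω)).ne']
    ring

lemma pmass_comp {Ω S T : Type*} [Fintype Ω] (μ : Ω → ℝ) (A : Ω → S) (f : S → T) (t : T) :
    pmass μ (fun ω => f (A ω)) t
      = ∑ a ∈ Finset.univ.image A, if f a = t then pmass μ A a else 0 := by
  have h1 : ∀ a ∈ Finset.univ.image A, (if f a = t then pmass μ A a else 0)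
      = ∑ ω, if A ω = a then (if f (A ω) = t then μ ω else 0) else 0 := by
    intro a _
    unfold pmass
    split_ifs with h
    · refine Finset.sum_congr rfl fun ω _ => ?_
      split_ifs with h2 h3 h3
      · rfl
      · exact absurd (h2 ▸ h) h3
      · rfl
    · symm
      refine Finset.sum_eq_zero fun ω _ => ?_
      split_ifs with h2 h3
      · exact absurd (h2 ▸ h3) h
      · rfl
      · rfl
  rw [Finset.sum_congr rfl h1, Finset.sum_comm]
  unfold pmass
  refine Finset.sum_congr rfl fun ω _ => ?_
  rw [Finset.sum_ite_eq]
  simp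

lemma pmass_marg {Ω S T : Type*} [Fintype Ω] (μ : Ω → ℝ) (A : Ω → S) (U : Ω → T) (s : S)
    (I : Finset T) (hI : ∀ ω, U ω ∈ I) :
    pmass μ A s = ∑ u ∈ I, pmass μ (fun ω => (A ω, U ω)) (s, u) := by
  unfold pmass
  rw [Finset.sum_comm]
  refine Finset.sum_congr rfl fun ω _ => ?_
  by_cases h : A ω = s
  · simp [h, hI]
  · simp [h]

lemma pmass_sum {Ω T : Type*} [Fintype Ω] (μ : Ω → ℝ) (U : Ω → T)
    (I : Finset T) (hI : ∀ ω, U ω ∈ I) :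
    ∑ u ∈ I, pmass μ U u = ∑ ω, μ ω := by
  unfold pmass
  rw [Finset.sum_comm]
  refine Finset.sum_congr rfl fun ω _ => ?_
  simp [hI]

lemma IndepPair.comp_left {Ω S T S' : Type*} [Fintype Ω] {μ : Ω → ℝ} {A : Ω → S} {B : Ω → T}
    (h : IndepPair μ A B) (f : S → S') : IndepPair μ (fun ω => f (A ω)) B := by
  intro s t
  have e1 : pmass μ (fun ω => (f (A ω), B ω)) (s, t)
      = ∑ a ∈ Finset.univ.image A, pmass μ (fun ω => ((f (A ω), B ω), A ω)) ((s, t), a) :=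
    pmass_marg _ _ _ _ _ (by simp)
  rw [e1, pmass_comp μ A f s, Finset.sum_mul]
  refine Finset.sum_congr rfl fun a _ => ?_
  split_ifs with hf
  · rw [← h a t]
    apply pmass_congr'
    intro ω
    simp only [Prod.mk.injEq]
    constructor
    · rintro ⟨⟨_, h2⟩, h3⟩; exact ⟨h3, h2⟩
    · rintro ⟨h3, h2⟩; exact ⟨⟨h3 ▸ hf, h2⟩, h3⟩
  · rw [zero_mul]
    unfold pmass
    refine Finset.sum_eq_zero fun ω _ => ?_
    rw [if_neg]
    simp only [Prod.mk.injEq]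
    rintro ⟨⟨h1, _⟩, h3⟩
    exact hf (h3 ▸ h1)

lemma pmass_prod {Ω₁ Ω₂ S T : Type*} [Fintype Ω₁] [Fintype Ω₂] (μ₁ : Ω₁ → ℝ) (μ₂ : Ω₂ → ℝ)
    (A : Ω₁ → S) (B : Ω₂ → T) (s : S) (t : T) :
    pmass (fun p : Ω₁ × Ω₂ => μ₁ p.1 * μ₂ p.2) (fun p => (A p.1, B p.2)) (s, t)
      = pmass μ₁ A s * pmass μ₂ B t := by
  unfold pmass
  rw [Finset.sum_mul_sum, ← Finset.univ_product_univ, Finset.sum_product]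
  refine Finset.sum_congr rfl fun a _ => Finset.sum_congr rfl fun b _ => ?_
  by_cases h1 : A a = s <;> by_cases h2 : B b = t <;> simp [h1, h2]

lemma pmass_fst {Ω₁ Ω₂ S : Type*} [Fintype Ω₁] [Fintype Ω₂] (μ₁ : Ω₁ → ℝ) (μ₂ : Ω₂ → ℝ)
    (h2 : ∑ ω, μ₂ ω = 1) (A : Ω₁ → S) (s : S) :
    pmass (fun p : Ω₁ × Ω₂ => μ₁ p.1 * μ₂ p.2) (fun p => A p.1) s = pmass μ₁ A s := by
  have := pmass_prod μ₁ μ₂ A (fun _ => ()) s ()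
  have e : pmass μ₂ (fun _ => ()) () = 1 := by simp [pmass, h2]
  rw [e, mul_one] at this
  rw [← this]
  exact pmass_congr' _ _ _ _ _ (by simp)

lemma pmass_snd {Ω₁ Ω₂ S : Type*} [Fintype Ω₁] [Fintype Ω₂] (μ₁ : Ω₁ → ℝ) (μ₂ : Ω₂ → ℝ)
    (h1 : ∑ ω, μ₁ ω = 1) (A : Ω₂ → S) (s : S) :
    pmass (fun p : Ω₁ × Ω₂ => μ₁ p.1 * μ₂ p.2) (fun p => A p.2) s = pmass μ₂ A s := by
  have := pmass_prod μ₁ μ₂ (fun _ => ()) A () s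
  have e : pmass μ₁ (fun _ => ()) () = 1 := by simp [pmass, h1]
  rw [e, one_mul] at this
  rw [← this]
  exact pmass_congr' _ _ _ _ _ (by simp)

lemma ent_fst {Ω₁ Ω₂ S : Type*} [Fintype Ω₁] [Fintype Ω₂] (μ₁ : Ω₁ → ℝ) (μ₂ : Ω₂ → ℝ)
    (h2 : ∑ ω, μ₂ ω = 1) (A : Ω₁ → S) :
    ent (fun p : Ω₁ × Ω₂ => μ₁ p.1 * μ₂ p.2) (fun p => A p.1) = ent μ₁ A := by
  rw [ent_eq, ent_eq, ← Finset.univ_product_univ, Finset.sum_product]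
  refine Finset.sum_congr rfl fun a _ => ?_
  simp only [pmass_fst μ₁ μ₂ h2 A]
  rw [← Finset.sum_mul, ← Finset.mul_sum, h2, mul_one]

lemma ent_snd {Ω₁ Ω₂ S : Type*} [Fintype Ω₁] [Fintype Ω₂] (μ₁ : Ω₁ → ℝ) (μ₂ : Ω₂ → ℝ)
    (h1 : ∑ ω, μ₁ ω = 1) (A : Ω₂ → S) :
    ent (fun p : Ω₁ × Ω₂ => μ₁ p.1 * μ₂ p.2) (fun p => A p.2) = ent μ₂ A := by
  rw [ent_eq, ent_eq, ← Finset.univ_product_univ, Finset.sum_product_right]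
  refine Finset.sum_congr rfl fun a _ => ?_
  simp only [pmass_snd μ₁ μ₂ h1 A]
  rw [← Finset.sum_mul, ← Finset.sum_mul, h1, one_mul]

lemma pmass_cond {Ω S T : Type*} [Fintype Ω] (μ : Ω → ℝ) (V : Ω → S) (W : Ω → T) (v : S) (w : T) :
    pmass (condMeas μ W w) V v = pmass μ (fun ω => (V ω, W ω)) (v, w) / pmass μ W w := by
  rw [pmass, pmass, Finset.sum_div]
  refine Finset.sum_congr rfl fun ω _ => ?_
  unfold condMeas
  by_cases h1 : V ω = v <;> by_cases h2 : W ω = w <;> simp [h1, h2]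

lemma cond_ent {Ω S T : Type*} [Fintype Ω] {μ : Ω → ℝ} (hμ : ∀ ω, 0 ≤ μ ω) (V : Ω → S) (W : Ω → T)
    (I : Finset T) (hI : ∀ ω, W ω ∈ I) :
    ∑ w ∈ I, pmass μ W w * ent (condMeas μ W w) V
      = ent μ (fun ω => (V ω, W ω)) - ent μ W := by
  have h1 : ∀ w ∈ I, pmass μ W w * ent (condMeas μ W w) V
      = ∑ ω, if W ω = w then μ ω * (-Real.log (pmass μ (fun ω => (V ω, W ω)) (V ω, w))
          + Real.log (pmass μ W w)) else 0 := by
    intro w _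
    rw [ent_eq, Finset.mul_sum]
    refine Finset.sum_congr rfl fun ω _ => ?_
    rw [pmass_cond]
    unfold condMeas
    split_ifs with h
    · subst h
      rcases (hμ ω).eq_or_lt with h0 | h0
      · rw [← h0]; simp
      · have p1 := (h0.trans_le (le_pmass hμ W ω)).ne'
        have p2 := (h0.trans_le (le_pmass hμ (fun ω => (V ω, W ω)) ω)).ne'
        rw [Real.log_div p2 p1]
        field_simp
        ring
    · simp
  rw [Finset.sum_congr rfl h1, Finset.sum_comm, ent_eq, ent_eq, ← Finset.sum_sub_distrib]
  refine Finset.sum_congr rfl fun ω _ => ?_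
  rw [Finset.sum_ite_eq, if_pos (hI ω)]
  ring

lemma submod_aux {Ω S T U : Type*} [Fintype Ω] {μ : Ω → ℝ} (hμ : ∀ ω, 0 ≤ μ ω)
    (A : Ω → S) (B : Ω → T) (C : Ω → U) :
    ∑ ω, μ ω * (pmass μ (fun ω => (A ω, C ω)) (A ω, C ω) * pmass μ (fun ω => (B ω, C ω)) (B ω, C ω)
      / (pmass μ (fun ω => (A ω, B ω, C ω)) (A ω, B ω, C ω) * pmass μ C (C ω))) ≤ ∑ ω, μ ω := by
  have e : ∀ ω, μ ω * (pmass μ (fun ω => (A ω, C ω)) (A ω, C ω)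
        * pmass μ (fun ω => (B ω, C ω)) (B ω, C ω)
      / (pmass μ (fun ω => (A ω, B ω, C ω)) (A ω, B ω, C ω) * pmass μ C (C ω)))
      = ∑ x, ∑ y, if C y = C x then μ x * μ y / pmass μ C (C x) *
        ((if (A ω, B ω, C ω) = (A x, B y, C x) then μ ω else 0) /
          pmass μ (fun ω => (A ω, B ω, C ω)) (A x, B y, C x)) else 0 := by
    intro ω
    conv_lhs => rw [pmass, pmass, Finset.sum_mul_sum, Finset.sum_div, Finset.mul_sum]
    refine Finset.sum_congr rfl fun x _ => ?_
    rw [Finset.sum_div, Finset.mul_sum]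
    refine Finset.sum_congr rfl fun y _ => ?_
    by_cases h1 : A x = A ω
    · by_cases h2 : B y = B ω
      · by_cases h3 : C x = C ω
        · by_cases h4 : C y = C ω
          · simp only [h1, h2, h3, h4, if_true]
            ring
          · simp [h3, h4]
        · simp [h3, Ne.symm h3]
      · simp [h2, Ne.symm h2]
    · simp [h1, Ne.symm h1]
  rw [Finset.sum_congr rfl (fun ω _ => e ω), Finset.sum_comm]
  refine Finset.sum_le_sum fun x _ => ?_
  rw [Finset.sum_comm]
  calc _ ≤ ∑ y, μ x / pmass μ C (C x) * (if C y = C x then μ y else 0) := by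
        refine Finset.sum_le_sum fun y _ => ?_
        split_ifs with h
        · rw [← Finset.mul_sum, ← Finset.sum_div]
          have : (∑ ω, if (A ω, B ω, C ω) = (A x, B y, C x) then μ ω else 0) /
              pmass μ (fun ω => (A ω, B ω, C ω)) (A x, B y, C x) ≤ 1 := by
            have hh : (∑ ω, if (A ω, B ω, C ω) = (A x, B y, C x) then μ ω else 0)
                = pmass μ (fun ω => (A ω, B ω, C ω)) (A x, B y, C x) := by
              unfold pmass
              refine Finset.sum_congr rfl fun ω _ => ?_
              congr
            rw [hh]
            exact div_self_le_one _
          have h0 : 0 ≤ μ x * μ y / pmass μ C (C x) :=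
            div_nonneg (mul_nonneg (hμ x) (hμ y)) (pmass_nn hμ _ _)
          calc _ ≤ μ x * μ y / pmass μ C (C x) * 1 := mul_le_mul_of_nonneg_left this h0
            _ = _ := by ring
        · simp
    _ = μ x * (pmass μ C (C x) / pmass μ C (C x)) := by
        rw [← Finset.mul_sum]
        change μ x / pmass μ C (C x) * pmass μ C (C x) = _
        ring
    _ ≤ μ x * 1 := mul_le_mul_of_nonneg_left (div_self_le_one _) (hμ x)
    _ = μ x := mul_one _

lemma submod {Ω S T U : Type*} [Fintype Ω] {μ : Ω → ℝ} (hμ : ∀ ω, 0 ≤ μ ω)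
    (A : Ω → S) (B : Ω → T) (C : Ω → U) :
    ent μ (fun ω => (A ω, B ω, C ω)) + ent μ C
      ≤ ent μ (fun ω => (A ω, C ω)) + ent μ (fun ω => (B ω, C ω)) := by
  have key := submod_aux hμ A B C
  rw [ent_eq, ent_eq, ent_eq, ent_eq, ← Finset.sum_add_distrib, ← Finset.sum_add_distrib]
  have : ∀ ω ∈ Finset.univ, μ ω * (-Real.log (pmass μ (fun ω => (A ω, B ω, C ω)) (A ω, B ω, C ω)))
      + μ ω * (-Real.log (pmass μ C (C ω)))
      ≤ (μ ω * (-Real.log (pmass μ (fun ω => (A ω, C ω)) (A ω, C ω)))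
      + μ ω * (-Real.log (pmass μ (fun ω => (B ω, C ω)) (B ω, C ω))))
      + (μ ω * (pmass μ (fun ω => (A ω, C ω)) (A ω, C ω)
        * pmass μ (fun ω => (B ω, C ω)) (B ω, C ω)
      / (pmass μ (fun ω => (A ω, B ω, C ω)) (A ω, B ω, C ω) * pmass μ C (C ω))) - μ ω) := by
    intro ω _
    rcases (hμ ω).eq_or_lt with h0 | h0
    · rw [← h0]; simp
    · have p1 := h0.trans_le (le_pmass hμ C ω)
      have p2 := h0.trans_le (le_pmass hμ (fun ω => (A ω, C ω)) ω)
      have p3 := h0.trans_le (le_pmass hμ (fun ω => (B ω, C ω)) ω)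
      have p4 := h0.trans_le (le_pmass hμ (fun ω => (A ω, B ω, C ω)) ω)
      have l := Real.log_le_sub_one_of_pos (div_pos (mul_pos p2 p3) (mul_pos p4 p1))
      rw [Real.log_div (mul_pos p2 p3).ne' (mul_pos p4 p1).ne', Real.log_mul p2.ne' p3.ne',
        Real.log_mul p4.ne' p1.ne'] at l
      have := mul_le_mul_of_nonneg_left l h0.le
      linarith
  have := Finset.sum_le_sum this
  rw [Finset.sum_add_distrib (f := fun ω => μ ω * (-Real.log (pmass μ (fun ω => (A ω, C ω)) (A ω, C ω)))
      + μ ω * (-Real.log (pmass μ (fun ω => (B ω, C ω)) (B ω, C ω)))), Finset.sum_sub_distrib] at this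
  linarith

lemma subadd {Ω S T : Type*} [Fintype Ω] {μ : Ω → ℝ} (hμ : IsProb μ)
    (A : Ω → S) (B : Ω → T) :
    ent μ (fun ω => (A ω, B ω)) ≤ ent μ A + ent μ B := by
  have h := submod hμ.1 A B (fun _ => ())
  have e0 : ent μ (fun _ : Ω => ()) = 0 := by
    rw [ent_eq]; simp [pmass, hμ.2]
  rw [e0, ent_congr μ (fun ω => (A ω, B ω, ())) (fun ω => (A ω, B ω)) (by simp),
    ent_congr μ (fun ω => (A ω, ())) A (by simp), ent_congr μ (fun ω => (B ω, ())) B (by simp)] at h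
  linarith

/-- **Lemma 6.1.** For `X, Y, Z, Z'` group-valued with `Y, Z, Z'` independent:
`d[X; Y - Z | Y - Z - Z'] - d[X; Y] ≤ (H[Y - Z - Z'] + H[Y - Z] - H[Y] - H[Z'])/2`. -/
theorem endgame_estimate {G Ω₁ Ω₂ : Type*} [AddCommGroup G] [Fintype Ω₁] [Fintype Ω₂]
    (μ₁ : Ω₁ → ℝ) (μ₂ : Ω₂ → ℝ) (hμ₁ : IsProb μ₁) (hμ₂ : IsProb μ₂)
    (X : Ω₁ → G) (Y Z Z' : Ω₂ → G) (hindep : IndepTriple μ₂ Y Z Z') :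
    condRdistRight μ₁ X μ₂ (fun ω => Y ω - Z ω) (fun ω => Y ω - Z ω - Z' ω)
        - rdist μ₁ X μ₂ Y
      ≤ (1/2) * (ent μ₂ (fun ω => Y ω - Z ω - Z' ω) + ent μ₂ (fun ω => Y ω - Z ω)
          - ent μ₂ Y - ent μ₂ Z') := by
  set P : Ω₁ × Ω₂ → ℝ := fun p => μ₁ p.1 * μ₂ p.2 with hP
  have hPn : ∀ p, 0 ≤ P p := fun p => mul_nonneg (hμ₁.1 _) (hμ₂.1 _)
  have hPp : IsProb P := by
    refine ⟨hPn, ?_⟩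
    rw [← Finset.univ_product_univ, Finset.sum_product]
    simp only [hP]
    rw [← Finset.sum_mul_sum, hμ₁.2, hμ₂.2, one_mul]
  -- independence facts
  have iYZ : IndepPair μ₂ Y Z := by
    intro s t
    rw [pmass_marg μ₂ (fun ω => (Y ω, Z ω)) Z' (s, t) (Finset.univ.image Z') (by simp)]
    have : ∀ u ∈ Finset.univ.image Z', pmass μ₂ (fun ω => ((Y ω, Z ω), Z' ω)) ((s, t), u)
        = pmass μ₂ Y s * pmass μ₂ Z t * pmass μ₂ Z' u := by
      intro u _
      rw [← hindep s t u]
      exact pmass_congr' _ _ _ _ _ (by simp [and_assoc])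
    rw [Finset.sum_congr rfl this, ← Finset.mul_sum, pmass_sum μ₂ Z' _ (by simp), hμ₂.2, mul_one]
  have iYZZ : IndepPair μ₂ (fun ω => (Y ω, Z ω)) Z' := by
    rintro ⟨s, t⟩ u
    rw [iYZ s t, ← hindep s t u]
    exact pmass_congr' _ _ _ _ _ (by simp [and_assoc])
  have iVZ : IndepPair μ₂ (fun ω => Y ω - Z ω) Z' := iYZZ.comp_left (fun q => q.1 - q.2)
  have iXYZ : IndepPair P (fun p => (X p.1, Y p.2)) (fun p => Z p.2) := by
    rintro ⟨x, y⟩ z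
    rw [pmass_prod μ₁ μ₂ X Y x y, pmass_snd μ₁ μ₂ hμ₁.2 Z z, mul_assoc, ← iYZ y z,
      ← pmass_prod μ₁ μ₂ X (fun ω => (Y ω, Z ω)) x (y, z)]
    exact pmass_congr' _ _ _ _ _ (by simp [and_assoc])
  have iDZ : IndepPair P (fun p => X p.1 - Y p.2) (fun p => Z p.2) :=
    iXYZ.comp_left (fun q => q.1 - q.2)
  have iprod : ∀ (B : Ω₂ → G), ent P (fun p => (X p.1, B p.2)) = ent μ₁ X + ent μ₂ B := by
    intro B
    have : IndepPair P (fun p => X p.1) (fun p => B p.2) := by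
      intro s t
      rw [pmass_prod μ₁ μ₂ X B, pmass_fst μ₁ μ₂ hμ₂.2, pmass_snd μ₁ μ₂ hμ₁.2]
    rw [ent_indep hPn _ _ this, ent_fst μ₁ μ₂ hμ₂.2, ent_snd μ₁ μ₂ hμ₁.2]
  -- Kaimanovich-Vershik
  have kv : ent P (fun p => X p.1 - (Y p.2 - Z p.2)) + ent μ₂ Y
      ≤ ent P (fun p => X p.1 - Y p.2) + ent μ₂ (fun ω => Y ω - Z ω) := by
    have h := submod hPn (fun p => X p.1) (fun p => Z p.2) (fun p => X p.1 - (Y p.2 - Z p.2))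
    have e1 : ent P (fun p => (X p.1, Z p.2, X p.1 - (Y p.2 - Z p.2)))
        = ent μ₁ X + ent μ₂ Y + ent μ₂ Z := by
      rw [← iprod Y, ← ent_snd μ₁ μ₂ hμ₁.2 Z, ← ent_indep hPn _ _ iXYZ]
      apply ent_congr
      intro p q
      simp only [Prod.mk.injEq]
      constructor
      · rintro ⟨a, b, c⟩
        rw [a, b] at c
        exact ⟨⟨a, by simpa using c⟩, b⟩
      · rintro ⟨⟨a, b⟩, c⟩
        rw [a, b, c]; simp
    have e2 : ent P (fun p => (X p.1, X p.1 - (Y p.2 - Z p.2)))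
        = ent μ₁ X + ent μ₂ (fun ω => Y ω - Z ω) := by
      rw [← iprod]
      apply ent_congr
      intro p q
      simp only [Prod.mk.injEq]
      constructor
      · rintro ⟨a, c⟩
        rw [a] at c
        exact ⟨a, sub_right_injective c⟩
      · rintro ⟨a, b⟩
        rw [a, b]; simp
    have e3 : ent P (fun p => (Z p.2, X p.1 - (Y p.2 - Z p.2)))
        = ent P (fun p => X p.1 - Y p.2) + ent μ₂ Z := by
      rw [← ent_snd μ₁ μ₂ hμ₁.2 Z, ← ent_indep hPn _ _ iDZ]
      apply ent_congr
      intro p q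
      simp only [Prod.mk.injEq, ← sub_add]
      constructor
      · rintro ⟨a, c⟩
        rw [a] at c
        exact ⟨add_left_injective _ c, a⟩
      · rintro ⟨a, b⟩
        rw [a, b]; simp
    linarith
  -- conditional distance
  have hW1 : ∑ w ∈ Finset.univ.image (fun ω => Y ω - Z ω - Z' ω),
      pmass μ₂ (fun ω => Y ω - Z ω - Z' ω) w = 1 := by
    rw [pmass_sum _ _ _ (by intro ω; exact Finset.mem_image_of_mem _ (Finset.mem_univ ω)), hμ₂.2]
  have c1 := cond_ent hμ₂.1 (fun ω => Y ω - Z ω) (fun ω => Y ω - Z ω - Z' ω)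
    (Finset.univ.image (fun ω => Y ω - Z ω - Z' ω))
    (by intro ω; exact Finset.mem_image_of_mem _ (Finset.mem_univ ω))
  have c2 := cond_ent hPn (fun p => X p.1 - (Y p.2 - Z p.2)) (fun p => Y p.2 - Z p.2 - Z' p.2)
    (Finset.univ.image (fun ω => Y ω - Z ω - Z' ω))
    (by intro p; exact Finset.mem_image_of_mem (fun ω => Y ω - Z ω - Z' ω) (Finset.mem_univ p.2))
  have c3 := subadd hPp (fun p => X p.1 - (Y p.2 - Z p.2)) (fun p => Y p.2 - Z p.2 - Z' p.2)
  have e4 : ent μ₂ (fun ω => (Y ω - Z ω, Y ω - Z ω - Z' ω))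
      = ent μ₂ (fun ω => Y ω - Z ω) + ent μ₂ Z' := by
    rw [← ent_indep hμ₂.1 _ _ iVZ]
    apply ent_congr
    intro p q
    simp only [Prod.mk.injEq]
    constructor
    · rintro ⟨a, c⟩
      rw [a] at c
      exact ⟨a, sub_right_injective c⟩
    · rintro ⟨a, b⟩
      rw [a, b]; simp
  have e5 : condRdistRight μ₁ X μ₂ (fun ω => Y ω - Z ω) (fun ω => Y ω - Z ω - Z' ω)
      = (∑ w ∈ Finset.univ.image (fun ω => Y ω - Z ω - Z' ω),
          pmass P (fun p => Y p.2 - Z p.2 - Z' p.2) w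
          * ent (condMeas P (fun p => Y p.2 - Z p.2 - Z' p.2) w) (fun p => X p.1 - (Y p.2 - Z p.2)))
        - (∑ w ∈ Finset.univ.image (fun ω => Y ω - Z ω - Z' ω),
          pmass μ₂ (fun ω => Y ω - Z ω - Z' ω) w) * (ent μ₁ X / 2)
        - (∑ w ∈ Finset.univ.image (fun ω => Y ω - Z ω - Z' ω),
          pmass μ₂ (fun ω => Y ω - Z ω - Z' ω) w
          * ent (condMeas μ₂ (fun ω => Y ω - Z ω - Z' ω) w) (fun ω => Y ω - Z ω)) / 2 := by
    rw [condRdistRight, Finset.sum_mul, Finset.sum_div, ← Finset.sum_sub_distrib,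
      ← Finset.sum_sub_distrib]
    refine Finset.sum_congr rfl fun w _ => ?_
    have pw := pmass_snd μ₁ μ₂ hμ₁.2 (fun ω => Y ω - Z ω - Z' ω) w
    have hm : condMeas P (fun p => Y p.2 - Z p.2 - Z' p.2) w
        = fun p => μ₁ p.1 * condMeas μ₂ (fun ω => Y ω - Z ω - Z' ω) w p.2 := by
      funext p
      simp only [condMeas]
      rw [pw]
      split_ifs
      · simp only [hP]; ring
      · simp
    rw [hm, pw, rdist]
    ring
  have e6 := ent_snd μ₁ μ₂ hμ₁.2 (fun ω => Y ω - Z ω - Z' ω)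
  rw [e5, hW1, c1, c2, e4, rdist]
  change ent P (fun p => Y p.2 - Z p.2 - Z' p.2) = _ at e6
  change _ - (ent P (fun p => X p.1 - Y p.2) - _ - _) ≤ _
  linarith


end
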